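/- (Second part of Proposition 2: well-posedness of the stationary HJB equation.) Let δ > 2Ū, let l be a Borel probability measure on Ω, and let U : Ω → ℝ be continuous with 0 ≤ U(x) ≤ Ū for all x ∈ Ω. Then there exists exactly one continuous function Φ : Ω → ℝ satisfying Φ(x) = U(x) + (1/(2δ)) ∫_Ω ((Φ(z) − Φ(x))₊)² l(dz) for every x ∈ Ω; moreover this Φ satisfies 0 ≤ Φ(x) ≤ Ū for all x ∈ Ω. -/

import Mathlib

open MeasureTheory

/-- The action space `Ω = [0,1] ⊆ ℝ` with its Borel σ-algebra. -/
abbrev Ω : Type := Set.Icc (0:ℝ) 1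

/-- Truncation of a real number to `[0, M]`. -/
noncomputable def clampM (M t : ℝ) : ℝ := max 0 (min t M)

lemma clampM_nonneg (M t : ℝ) : 0 ≤ clampM M t := le_max_left _ _

lemma clampM_le {M : ℝ} (hM : 0 < M) (t : ℝ) : clampM M t ≤ M :=
  max_le hM.le (min_le_right _ _)

lemma clampM_eq {M t : ℝ} (h0 : 0 ≤ t) (h1 : t ≤ M) : clampM M t = t := by
  rw [clampM, min_eq_left h1, max_eq_right h0]

lemma clampM_lip (M s t : ℝ) : |clampM M s - clampM M t| ≤ |s - t| := by
  unfold clampM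
  refine (abs_max_sub_max_le_max _ _ _ _).trans ?_
  refine max_le (by simp) ((abs_min_sub_min_le_max _ _ _ _).trans ?_)
  simp

lemma clampM_cont (M : ℝ) : Continuous (clampM M) := by
  unfold clampM; fun_prop

lemma sq_lip {M a b a' b' d : ℝ} (ha : 0 ≤ a ∧ a ≤ M) (hb : 0 ≤ b ∧ b ≤ M)
    (ha' : 0 ≤ a' ∧ a' ≤ M) (hb' : 0 ≤ b' ∧ b' ≤ M) (h1 : |a - a'| ≤ d) (h2 : |b - b'| ≤ d) :
    |(max (a - b) 0) ^ 2 - (max (a' - b') 0) ^ 2| ≤ 4 * M * d := by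
  have h3 : |max (a - b) 0 - max (a' - b') 0| ≤ 2 * d := by
    refine (abs_max_sub_max_le_max _ _ _ _).trans (max_le ?_ ?_)
    · rw [abs_le] at *; constructor <;> linarith
    · have := abs_nonneg (a - a')
      simp; linarith
  have hp : 0 ≤ max (a - b) 0 := le_max_right _ _
  have hq : 0 ≤ max (a' - b') 0 := le_max_right _ _
  have hp1 : max (a - b) 0 ≤ M := max_le (by linarith) (by linarith)
  have hq1 : max (a' - b') 0 ≤ M := max_le (by linarith) (by linarith)
  rw [sq_sub_sq, abs_mul, abs_of_nonneg (add_nonneg hp hq)]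
  calc _ ≤ (2 * M) * (2 * d) := mul_le_mul (by linarith) h3 (abs_nonneg _) (by linarith)
    _ = _ := by ring

lemma int_cont (l : Measure Ω) [IsProbabilityMeasure l] (g : Ω → ℝ) (hg : Continuous g) :
    Continuous fun x => ∫ z, (max (g z - g x) 0) ^ 2 ∂l := by
  have : Continuous (Function.uncurry fun x z : Ω => (max (g z - g x) 0) ^ 2) := by
    unfold Function.uncurry; fun_prop
  have h2 := continuous_parametric_integral_of_continuous (μ := l) this isCompact_univ
  simpa using h2

/-- The truncated HJB operator. -/
noncomputable def hjbT (M δ : ℝ) (l : Measure Ω) [IsProbabilityMeasure l]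
    (U : Ω → ℝ) (hUc : Continuous U) (f : C(Ω, ℝ)) : C(Ω, ℝ) where
  toFun x := min M (U x + (1 / (2 * δ)) *
    ∫ z, (max (clampM M (f z) - clampM M (f x)) 0) ^ 2 ∂l)
  continuous_toFun := by
    have := int_cont l (fun x => clampM M (f x)) ((clampM_cont M).comp f.continuous)
    fun_prop

lemma hjb_bounds
    (Ubar : ℝ) (hUbar : 0 < Ubar)
    (δ : ℝ) (hδ : 2 * Ubar < δ)
    (l : Measure Ω) [IsProbabilityMeasure l]
    (U : Ω → ℝ) (hU : ∀ x, 0 ≤ U x ∧ U x ≤ Ubar) (Φ : Ω → ℝ) (hc : Continuous Φ)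
    (h : ∀ x, Φ x = U x + (1 / (2 * δ)) * ∫ z, (max (Φ z - Φ x) 0) ^ 2 ∂l) :
    ∀ x, 0 ≤ Φ x ∧ Φ x ≤ Ubar := by
  have hd : 0 < δ := by linarith
  obtain ⟨m, -, hm⟩ := isCompact_univ.exists_isMaxOn Set.univ_nonempty hc.continuousOn
  have hm' : ∀ z, Φ z ≤ Φ m := fun z => hm (Set.mem_univ z)
  intro x
  constructor
  · rw [h x]
    have : 0 ≤ ∫ z, (max (Φ z - Φ x) 0) ^ 2 ∂l := integral_nonneg fun z => sq_nonneg _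
    have := (hU x).1
    positivity
  · refine (hm' x).trans ?_
    rw [h m]
    have : ∀ z, (max (Φ z - Φ m) 0) ^ 2 = 0 := fun z => by
      rw [max_eq_right (by linarith [hm' z])]; simp
    simp [this, (hU m).2]

lemma hjbT_contr
    (Ubar : ℝ) (hUbar : 0 < Ubar)
    (δ : ℝ) (hδ : 2 * Ubar < δ)
    (l : Measure Ω) [IsProbabilityMeasure l]
    (U : Ω → ℝ) (hUc : Continuous U) :
    ContractingWith (Real.toNNReal (2 * Ubar / δ)) (hjbT Ubar δ l U hUc) := by
  have hd : 0 < δ := by linarith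
  refine ⟨?_, LipschitzWith.of_dist_le_mul fun f g => ?_⟩
  · rw [Real.toNNReal_lt_one, div_lt_one hd]; exact hδ
  rw [Real.coe_toNNReal _ (by positivity), ContinuousMap.dist_le (by positivity)]
  intro x
  have hfg : ∀ z, |clampM Ubar (f z) - clampM Ubar (g z)| ≤ dist f g := fun z =>
    (clampM_lip _ _ _).trans
      ((Real.dist_eq _ _).symm.trans_le (ContinuousMap.dist_apply_le_dist (f := f) (g := g) z))
  have hint : ∀ k : C(Ω, ℝ),
      Integrable (fun z => (max (clampM Ubar (k z) - clampM Ubar (k x)) 0) ^ 2) l := fun k => by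
    have hc : Continuous fun z => (max (clampM Ubar (k z) - clampM Ubar (k x)) 0) ^ 2 := by
      have := (clampM_cont Ubar).comp k.continuous
      have h2 : Continuous fun z => clampM Ubar (k z) := this
      fun_prop
    exact hc.integrable_of_hasCompactSupport (HasCompactSupport.of_compactSpace _)
  have hb : ∀ t, 0 ≤ clampM Ubar t ∧ clampM Ubar t ≤ Ubar := fun t =>
    ⟨clampM_nonneg _ _, clampM_le hUbar _⟩
  have key : |(∫ z, (max (clampM Ubar (f z) - clampM Ubar (f x)) 0) ^ 2 ∂l) -
      ∫ z, (max (clampM Ubar (g z) - clampM Ubar (g x)) 0) ^ 2 ∂l| ≤ 4 * Ubar * dist f g := by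
    rw [← integral_sub (hint f) (hint g)]
    have := norm_integral_le_of_norm_le_const (μ := l) (C := 4 * Ubar * dist f g)
      (f := fun z => (max (clampM Ubar (f z) - clampM Ubar (f x)) 0) ^ 2 -
        (max (clampM Ubar (g z) - clampM Ubar (g x)) 0) ^ 2)
      (Filter.Eventually.of_forall fun z =>
        sq_lip (hb _) (hb _) (hb _) (hb _) (hfg z) (hfg x))
    simpa using this
  rw [Real.dist_eq]
  refine (abs_min_sub_min_le_max _ _ _ _).trans (max_le (by simp; positivity) ?_)
  rw [add_sub_add_left_eq_sub, ← mul_sub, abs_mul, abs_of_pos (by positivity)]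
  calc _ ≤ 1 / (2 * δ) * (4 * Ubar * dist f g) := by gcongr
    _ = _ := by field_simp; ring

theorem stmt1
    (Ubar : ℝ) (hUbar : 0 < Ubar)
    (δ : ℝ) (hδ : 2 * Ubar < δ)
    (l : Measure Ω) [IsProbabilityMeasure l]
    (U : Ω → ℝ) (hUc : Continuous U) (hU : ∀ x, 0 ≤ U x ∧ U x ≤ Ubar) :
    (∃! Φ : Ω → ℝ, Continuous Φ ∧
        ∀ x, Φ x = U x + (1 / (2 * δ)) * ∫ z, (max (Φ z - Φ x) 0) ^ 2 ∂l) ∧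
    (∀ Φ : Ω → ℝ, Continuous Φ →
        (∀ x, Φ x = U x + (1 / (2 * δ)) * ∫ z, (max (Φ z - Φ x) 0) ^ 2 ∂l) →
        ∀ x, 0 ≤ Φ x ∧ Φ x ≤ Ubar) := by
  have hd : 0 < δ := by linarith
  have hB := hjb_bounds Ubar hUbar δ hδ l U hU
  have hC := hjbT_contr Ubar hUbar δ hδ l U hUc
  refine ⟨?_, hB⟩
  have fix : ∀ Φ : Ω → ℝ, ∀ hc : Continuous Φ,
      (∀ x, Φ x = U x + (1 / (2 * δ)) * ∫ z, (max (Φ z - Φ x) 0) ^ 2 ∂l) →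
      Function.IsFixedPt (hjbT Ubar δ l U hUc) ⟨Φ, hc⟩ := by
    intro Φ hc h
    have hb := hB Φ hc h
    have he : ∀ z, clampM Ubar (Φ z) = Φ z := fun z => clampM_eq (hb z).1 (hb z).2
    ext x
    simp only [hjbT, ContinuousMap.coe_mk, he]
    rw [← h x, min_eq_right (hb x).2]
  have hp := hC.fixedPoint_isFixedPt
  set p := hC.fixedPoint (hjbT Ubar δ l U hUc)
  have hpx : ∀ x, p x = min Ubar (U x + (1 / (2 * δ)) *
      ∫ z, (max (clampM Ubar (p z) - clampM Ubar (p x)) 0) ^ 2 ∂l) := fun x =>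
    (DFunLike.congr_fun hp x).symm
  have hp1 : ∀ x, p x ≤ Ubar := fun x => (hpx x).trans_le (min_le_left _ _)
  have hp0 : ∀ x, 0 ≤ p x := fun x => by
    rw [hpx x]
    have : 0 ≤ ∫ z, (max (clampM Ubar (p z) - clampM Ubar (p x)) 0) ^ 2 ∂l :=
      integral_nonneg fun z => sq_nonneg _
    have := (hU x).1
    exact le_min hUbar.le (by positivity)
  have he : ∀ z, clampM Ubar (p z) = p z := fun z => clampM_eq (hp0 z) (hp1 z)
  simp only [he] at hpx
  refine ⟨p, ⟨p.continuous, fun x => ?_⟩, ?_⟩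
  · rcases le_total (U x + (1 / (2 * δ)) * ∫ z, (max (p z - p x) 0) ^ 2 ∂l) Ubar with h | h
    · have := hpx x
      rwa [min_eq_right h] at this
    · have h1 := hpx x
      rw [min_eq_left h] at h1
      have hz : ∀ z, (max (p z - p x) 0) ^ 2 = 0 := fun z => by
        rw [max_eq_right (by linarith [hp1 z])]; simp
      simp only [hz, integral_zero, mul_zero, add_zero] at h ⊢
      linarith [(hU x).2]
  · rintro Ψ ⟨hc, h⟩
    have := hC.fixedPoint_unique (fix Ψ hc h)
    exact congrArg DFunLike.coe this
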